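/- Let 0 < p₀ ≤ p₁ ≤ ∞ and s ∈ ℝ. There exists C ≥ 0 such that for every F ∈ T^{p₀}_s(S*) with F(x,ω,σ) = 0 whenever σ > e, one has F ∈ T^{p₁}_{s - n(1/p₀ - 1/p₁)}(S*) and ‖F‖_{T^{p₁}_{s - n(1/p₀ - 1/p₁)}(S*)} ≤ C ‖F‖_{T^{p₀}_s(S*)}. -/

import Mathlib

open MeasureTheory Metric Set
open scoped ENNReal NNReal FourierTransform

noncomputable section

abbrev En (n : ℕ) := EuclideanSpace ℝ (Fin n)
abbrev Sph (n : ℕ) := Metric.sphere (0 : En n) 1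
abbrev CoSph (n : ℕ) := En n × Sph n

/-- The quasi-metric ρ((x,ω),(y,ν)) = (|ω·(x−y)| + |x−y|² + |ω−ν|²)^{1/2}. -/
def rho {n : ℕ} (a b : CoSph n) : ℝ :=
  Real.sqrt (abs (inner (𝕜 := ℝ) ((a.2 : En n)) (a.1 - b.1)) + ‖a.1 - b.1‖ ^ 2 +
    ‖(a.2 : En n) - (b.2 : En n)‖ ^ 2)

/-- The normalized surface measure on the unit sphere. -/
def sphMeasure (n : ℕ) : Measure (Sph n) :=
  ((volume : Measure (En n)).toSphere Set.univ)⁻¹ • (volume : Measure (En n)).toSphere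

/-- The measure dx dω on the cosphere bundle S* = ℝⁿ × S^{n-1}. -/
def muS (n : ℕ) : Measure (CoSph n) := (volume : Measure (En n)).prod (sphMeasure n)

/-- Ball in the quasi-metric ρ. -/
def rball {n : ℕ} (a : CoSph n) (τ : ℝ) : Set (CoSph n) := {b | rho a b < τ}

/-- The weighted conical square function
A_s F(x,ω) = (∫₀^∞ ⨍_{B_{√σ}(x,ω)} |F(y,ν,σ)|² dy dν dσ/σ^{1+2s})^{1/2}. -/
def conAs {n : ℕ} (s : ℝ) (F : CoSph n × ℝ → ℂ) (a : CoSph n) : ℝ≥0∞ :=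
  (∫⁻ σ in Set.Ioi (0 : ℝ),
      (muS n (rball a (Real.sqrt σ)))⁻¹ *
        (∫⁻ b in rball a (Real.sqrt σ), (‖F (b, σ)‖₊ : ℝ≥0∞) ^ (2 : ℝ) ∂(muS n)) *
        ENNReal.ofReal (σ ^ (-(1 : ℝ) - 2 * s))) ^ (1 / 2 : ℝ)

/-- The tent T(B) over the ball B = B_r(c): points (b,σ) with 0 < σ and
ρ-distance from b to the complement of B at least √σ. -/
def tentOver {n : ℕ} (c : CoSph n) (r : ℝ) : Set (CoSph n × ℝ) :=
  {q | 0 < q.2 ∧ ∀ b : CoSph n, rho q.1 b < Real.sqrt q.2 → b ∈ rball c r}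

/-- The weighted Carleson functional
C_s F(x,ω) = sup_{B ∋ (x,ω)} (|B|⁻¹ ∫_{T(B)} |F|² dy dν dσ/σ^{1+2s})^{1/2}. -/
def carlCs {n : ℕ} (s : ℝ) (F : CoSph n × ℝ → ℂ) (a : CoSph n) : ℝ≥0∞ :=
  ⨆ (c : CoSph n) (r : ℝ) (_ : 0 < r) (_ : a ∈ rball c r),
    ((muS n (rball c r))⁻¹ *
      ∫⁻ q in tentOver c r, (‖F q‖₊ : ℝ≥0∞) ^ (2 : ℝ) * ENNReal.ofReal (q.2 ^ (-(1 : ℝ) - 2 * s))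
        ∂((muS n).prod (volume : Measure ℝ))) ^ (1 / 2 : ℝ)

/-- The quasi-norm of the weighted tent space T^p_s(S*), defined for 0 < p ≤ ∞:
for finite p it is ‖A_s F‖_{L^p(S*)}, for p = ∞ it is ‖C_s F‖_{L^∞(S*)}. -/
def tentNorm {n : ℕ} (p : ℝ≥0∞) (s : ℝ) (F : CoSph n × ℝ → ℂ) : ℝ≥0∞ :=
  if p = ∞ then essSup (fun a => carlCs s F a) (muS n)
  else (∫⁻ a, conAs s F a ^ p.toReal ∂(muS n)) ^ (1 / p.toReal)

section abstractPart
variable {X : Type*} [MeasurableSpace X]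

def hh (μ : Measure X) (D : X → X → ℝ) (G : X × ℝ → ℝ≥0∞) (a : X) (σ : ℝ) : ℝ≥0∞ :=
  (μ {b | D a b < σ})⁻¹ * ∫⁻ b in {b | D a b < σ}, G (b, σ) ∂μ

def AA (μ : Measure X) (D : X → X → ℝ) (G : X × ℝ → ℝ≥0∞) (a : X) : ℝ≥0∞ :=
  ∫⁻ σ in Ioi (0:ℝ), hh μ D G a σ

lemma meas_ball {D : X → X → ℝ} (hD : Measurable fun p : X × X => D p.1 p.2) (a : X) (σ : ℝ) :
    MeasurableSet {b | D a b < σ} :=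
  measurableSet_lt (hD.comp (measurable_const.prodMk measurable_id)) measurable_const

lemma meas_ball' {D : X → X → ℝ} (hD : Measurable fun p : X × X => D p.1 p.2) (a : X) (σ : ℝ) :
    MeasurableSet {b | D b a < σ} :=
  measurableSet_lt (hD.comp (measurable_id.prodMk measurable_const)) measurable_const

lemma meas_hh (μ : Measure X) [SFinite μ] {D : X → X → ℝ}
    (hD : Measurable fun p : X × X => D p.1 p.2) {G : X × ℝ → ℝ≥0∞} (hG : Measurable G) :
    Measurable fun p : X × ℝ => hh μ D G p.1 p.2 := by
  have hS : MeasurableSet {q : (X × ℝ) × X | D q.1.1 q.2 < q.1.2} :=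
    measurableSet_lt (hD.comp ((measurable_fst.comp measurable_fst).prodMk measurable_snd))
      (measurable_snd.comp measurable_fst)
  have h1 : Measurable fun p : X × ℝ => μ {b | D p.1 b < p.2} := measurable_measure_prodMk_left hS
  have h2 : Measurable fun p : X × ℝ => ∫⁻ b in {b | D p.1 b < p.2}, G (b, p.2) ∂μ := by
    have : (fun p : X × ℝ => ∫⁻ b in {b | D p.1 b < p.2}, G (b, p.2) ∂μ) =
        fun p : X × ℝ => ∫⁻ b, ({q : (X × ℝ) × X | D q.1.1 q.2 < q.1.2}.indicator
          (fun q => G (q.2, q.1.2))) (p, b) ∂μ := by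
      funext p
      rw [← lintegral_indicator (meas_ball hD p.1 p.2)]
      rfl
    rw [this]
    refine Measurable.lintegral_prod_right' (Measurable.indicator ?_ hS)
    exact hG.comp (measurable_snd.prodMk (measurable_snd.comp measurable_fst))
  exact h1.inv.mul h2

lemma meas_hhr (μ : Measure X) [SFinite μ] {D : X → X → ℝ}
    (hD : Measurable fun p : X × X => D p.1 p.2) {G : X × ℝ → ℝ≥0∞} (hG : Measurable G) (a : X) :
    Measurable fun σ => hh μ D G a σ := by
  have h1 := meas_hh μ hD hG
  have h2 : Measurable fun σ : ℝ => (a, σ) := measurable_prodMk_left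
  generalize hf : hh μ D G = f at *
  exact h1.comp h2

lemma meas_AA (μ : Measure X) [SFinite μ] {D : X → X → ℝ}
    (hD : Measurable fun p : X × X => D p.1 p.2) {G : X × ℝ → ℝ≥0∞} (hG : Measurable G) :
    Measurable fun a => AA μ D G a :=
  (meas_hh μ hD hG).lintegral_prod_right'

/-- window measure -/
def lam (μ : Measure X) (G : X × ℝ → ℝ≥0∞) (S : Set ℝ) : Measure X :=
  ((μ.prod (volume.restrict S)).withDensity G).map Prod.fst

lemma lam_apply (μ : Measure X) [SFinite μ] {G : X × ℝ → ℝ≥0∞} (hG : Measurable G)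
    (S : Set ℝ) {E : Set X} (hE : MeasurableSet E) :
    lam μ G S E = ∫⁻ σ in S, ∫⁻ b in E, G (b, σ) ∂μ := by
  have h : (Prod.fst ⁻¹' E : Set (X × ℝ)) = E ×ˢ univ := by ext; simp
  rw [lam, Measure.map_apply measurable_fst hE, withDensity_apply _ (measurable_fst hE), h,
    ← Measure.prod_restrict, Measure.restrict_univ, lintegral_prod_symm _ hG.aemeasurable]

instance (μ : Measure X) [SFinite μ] (G : X × ℝ → ℝ≥0∞) (S : Set ℝ) : SFinite (lam μ G S) := by
  unfold lam; infer_instance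

lemma ofReal_rpow_scale (k t ν : ℝ) (hk : 0 < k) (ht : 0 < t) :
    ENNReal.ofReal ((k * t) ^ ν) = ENNReal.ofReal (k ^ ν) * ENNReal.ofReal (t ^ ν) := by
  rw [Real.mul_rpow hk.le ht.le, ENNReal.ofReal_mul (by positivity)]

/-- hypotheses on the quasi metric -/
structure QM (μ : Measure X) (D : X → X → ℝ) (ν : ℝ) (c C : ℝ≥0∞) : Prop where
  meas : Measurable fun p : X × X => D p.1 p.2
  symm : ∀ a b, D b a ≤ 2 * D a b
  tri : ∀ a b d, D a d ≤ 3 * (D a b + D b d)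
  c0 : c ≠ 0
  ct : c ≠ ∞
  C0 : C ≠ 0
  Ct : C ≠ ∞
  lower : ∀ a σ, 0 < σ → σ ≤ 100 → c * ENNReal.ofReal (σ ^ ν) ≤ μ {b | D a b < σ}
  upper : ∀ a σ, 0 < σ → σ ≤ 100 → μ {b | D a b < σ} ≤ C * ENNReal.ofReal (σ ^ ν)

variable {μ : Measure X} [SFinite μ] {D : X → X → ℝ} {ν : ℝ} {c C : ℝ≥0∞}

lemma step1 (H : QM μ D ν c C) {G : X × ℝ → ℝ≥0∞} (hG : Measurable G) (hν : 0 < ν)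
    {t : ℝ} (ht : 0 < t) (ht3 : t ≤ 3) (x a : X) (ha : D x a < t / 9) :
    lam μ G (Icc t (2*t)) {b | D x b < t / 9} ≤
      (C * ENNReal.ofReal ((2 * t) ^ ν)) * AA μ D G a := by
  set K := C * ENNReal.ofReal ((2 * t) ^ ν) with hK
  have hK0 : K ≠ 0 := mul_ne_zero H.C0 (by simp; positivity)
  have hKt : K ≠ ∞ := ENNReal.mul_ne_top H.Ct (by simp)
  rw [← ENNReal.inv_mul_le_iff hK0 hKt, lam_apply μ hG _ (meas_ball H.meas _ _),
    ← lintegral_const_mul' _ _ (by simpa using hK0)]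
  unfold AA
  refine le_trans ?_ (lintegral_mono_set (s := Icc t (2*t)) (fun σ hσ => lt_of_lt_of_le ht hσ.1))
  refine setLIntegral_mono' measurableSet_Icc fun σ hσ => ?_
  unfold hh
  refine mul_le_mul' (ENNReal.inv_le_inv.2 ?_) (lintegral_mono_set ?_)
  · refine (H.upper a σ (by linarith [hσ.1]) (by linarith [hσ.2])).trans ?_
    rw [hK]
    gcongr
    · linarith [hσ.1]
    · exact hσ.2
  · intro b hb
    simp only [mem_ofPred_eq] at hb ⊢
    have := H.tri a x b
    have := H.symm x a
    have := hσ.1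
    linarith

lemma step2 (H : QM μ D ν c C) {G : X × ℝ → ℝ≥0∞} (hG : Measurable G) (hν : 0 < ν)
    {P : ℝ} (hP : 0 < P)
    {t : ℝ} (ht : 0 < t) (ht3 : t ≤ 3) (x : X) :
    lam μ G (Icc t (2*t)) {b | D x b < t / 9} ≤
      (C * ENNReal.ofReal ((2 * t) ^ ν)) *
        ((∫⁻ a, AA μ D G a ^ P ∂μ) / (c * ENNReal.ofReal ((t/9) ^ ν))) ^ (1 / P) := by
  set K := C * ENNReal.ofReal ((2 * t) ^ ν) with hK
  set I := lam μ G (Icc t (2*t)) {b | D x b < t / 9} with hI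
  set m := c * ENNReal.ofReal ((t/9) ^ ν) with hm
  have hm0 : m ≠ 0 := mul_ne_zero H.c0 (by simp; positivity)
  have hmt : m ≠ ∞ := ENNReal.mul_ne_top H.ct (by simp)
  have h1 : I ^ P * m ≤ K ^ P * ∫⁻ a, AA μ D G a ^ P ∂μ := by
    calc I ^ P * m ≤ I ^ P * μ {b | D x b < t / 9} := by
          gcongr; exact H.lower x (t/9) (by positivity) (by linarith)
      _ = ∫⁻ a in {b | D x b < t / 9}, I ^ P ∂μ := by rw [setLIntegral_const]
      _ ≤ ∫⁻ a in {b | D x b < t / 9}, K ^ P * AA μ D G a ^ P ∂μ := by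
          refine setLIntegral_mono' (meas_ball H.meas _ _) fun a ha => ?_
          rw [← ENNReal.mul_rpow_of_nonneg _ _ hP.le]
          exact ENNReal.rpow_le_rpow (step1 H hG hν ht ht3 x a ha) hP.le
      _ ≤ ∫⁻ a, K ^ P * AA μ D G a ^ P ∂μ := setLIntegral_le_lintegral _ _
      _ = _ := by rw [lintegral_const_mul _ ((meas_AA μ H.meas hG).pow_const P)]
  have h2 : I ^ P ≤ K ^ P * ((∫⁻ a, AA μ D G a ^ P ∂μ) / m) := by
    rw [← mul_div_assoc, ENNReal.le_div_iff_mul_le (Or.inl hm0) (Or.inl hmt)]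
    exact h1
  calc I = (I ^ P) ^ (1/P) := by rw [← ENNReal.rpow_mul, mul_one_div_cancel hP.ne', ENNReal.rpow_one]
    _ ≤ _ := ENNReal.rpow_le_rpow h2 (by positivity)
    _ = _ := by
      rw [ENNReal.mul_rpow_of_nonneg _ _ (by positivity), ← ENNReal.rpow_mul,
        mul_one_div_cancel hP.ne', ENNReal.rpow_one]

lemma step3 (H : QM μ D ν c C) {G : X × ℝ → ℝ≥0∞}
    {t : ℝ} (ht : 0 < t) (ht3 : t ≤ 3) (a : X) (Q : ℝ≥0∞)
    (hQ : ∀ x, lam μ G (Icc t (2*t)) {b | D x b < t / 9} ≤ Q) :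
    (c * ENNReal.ofReal ((t/18) ^ ν)) * lam μ G (Icc t (2*t)) {b | D a b < 2 * t} ≤
      Q * (C * ENNReal.ofReal ((7 * t) ^ ν)) := by
  set L := lam μ G (Icc t (2*t)) with hL
  set B := {b | D a b < 7 * t} with hB
  have hBm : MeasurableSet B := meas_ball H.meas _ _
  have hS : MeasurableSet {q : X × X | D q.1 q.2 < t / 9} := measurableSet_lt H.meas measurable_const
  have e1 : ((μ.restrict B).prod L) {q : X × X | D q.1 q.2 < t / 9} =
      ∫⁻ x in B, L {b | D x b < t / 9} ∂μ := Measure.prod_apply hS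
  have e2 : ((μ.restrict B).prod L) {q : X × X | D q.1 q.2 < t / 9} =
      ∫⁻ b, (μ.restrict B) {x | D x b < t / 9} ∂L := Measure.prod_apply_symm hS
  calc _ = ∫⁻ b in {b | D a b < 2 * t}, (c * ENNReal.ofReal ((t/18) ^ ν)) ∂L := by
        rw [setLIntegral_const]
    _ ≤ ∫⁻ b in {b | D a b < 2 * t}, (μ.restrict B) {x | D x b < t / 9} ∂L := by
        refine setLIntegral_mono' (meas_ball H.meas _ _) fun b hb => ?_
        refine (H.lower b (t/18) (by positivity) (by linarith)).trans ?_
        rw [Measure.restrict_apply (meas_ball' H.meas _ _)]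
        refine measure_mono fun x hx => ?_
        simp only [mem_ofPred_eq, mem_inter_iff, hB] at hx hb ⊢
        have := H.symm b x
        have := H.tri a b x
        constructor <;> linarith
    _ ≤ ∫⁻ b, (μ.restrict B) {x | D x b < t / 9} ∂L := setLIntegral_le_lintegral _ _
    _ = ∫⁻ x in B, L {b | D x b < t / 9} ∂μ := by rw [← e2, e1]
    _ ≤ ∫⁻ x in B, Q ∂μ := lintegral_mono fun x => hQ x
    _ = Q * μ B := by rw [setLIntegral_const]
    _ ≤ _ := by gcongr; exact H.upper a _ (by positivity) (by linarith)

lemma window (H : QM μ D ν c C) (hν : 0 < ν) {P : ℝ} (hP : 0 < P) :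
    ∃ C1 : ℝ≥0∞, C1 ≠ ∞ ∧ ∀ G : X × ℝ → ℝ≥0∞, Measurable G →
      (∀ b σ, 3 < σ → G (b, σ) = 0) → ∀ t, 0 < t → ∀ a,
      ∫⁻ σ in Icc t (2*t), hh μ D G a σ ≤
        C1 * ENNReal.ofReal (t ^ (-(ν / P))) * (∫⁻ a, AA μ D G a ^ P ∂μ) ^ (1 / P) := by
  let k := fun x : ℝ => ENNReal.ofReal (x ^ ν)
  have hk0 : ∀ x, 0 < x → k x ≠ 0 := fun x hx => by simp [k]; positivity
  have hkt : ∀ x, k x ≠ ∞ := fun x => by simp [k]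
  refine ⟨c⁻¹ * ((c * k (1/18))⁻¹ * ((C * k 2) * ((c * k (1/9))⁻¹) ^ (1 / P) * (C * k 7))), ?_, ?_⟩
  · have h9 : (c * k (1/9))⁻¹ ≠ ∞ := by
      simp only [ne_eq, ENNReal.inv_eq_top]; exact mul_ne_zero H.c0 (hk0 _ (by norm_num))
    have h18 : (c * k (1/18))⁻¹ ≠ ∞ := by
      simp only [ne_eq, ENNReal.inv_eq_top]; exact mul_ne_zero H.c0 (hk0 _ (by norm_num))
    have := ENNReal.rpow_ne_top_of_nonneg (y := 1/P) (by positivity) h9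
    refine ENNReal.mul_ne_top (by simpa using H.c0) (ENNReal.mul_ne_top h18 (ENNReal.mul_ne_top
      (ENNReal.mul_ne_top (ENNReal.mul_ne_top H.Ct (hkt _)) this) (ENNReal.mul_ne_top H.Ct (hkt _))))
  intro G hG hG0 t ht a
  by_cases ht3 : 3 < t
  · have : ∫⁻ σ in Icc t (2*t), hh μ D G a σ = 0 := by
      rw [setLIntegral_congr_fun (g := fun _ => 0) measurableSet_Icc]
      · simp
      · intro σ hσ
        have : ∀ b, G (b, σ) = 0 := fun b => hG0 b σ (lt_of_lt_of_le ht3 hσ.1)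
        simp [hh, this]
    rw [this]; exact zero_le
  push Not at ht3
  have sc : ∀ x, 0 < x → ENNReal.ofReal ((x * t) ^ ν) = k x * k t := fun x hx =>
    ofReal_rpow_scale x t ν hx ht
  have e9 : t / 9 = (1/9) * t := by ring
  have e18 : t / 18 = (1/18) * t := by ring
  have h3 := step3 H ht ht3 a _ (fun x => step2 H hG hν hP ht ht3 x)
  rw [lam_apply μ hG _ (meas_ball H.meas _ _), e9, e18, sc _ (by norm_num), sc _ (by norm_num),
    sc _ (by norm_num), sc _ (by norm_num)] at h3
  have h4 : ∫⁻ σ in Icc t (2*t), hh μ D G a σ ≤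
      (c * k t)⁻¹ * ∫⁻ σ in Icc t (2*t), ∫⁻ b in {b | D a b < 2 * t}, G (b, σ) ∂μ := by
    rw [← lintegral_const_mul' _ _ (by
      simp only [ne_eq, ENNReal.inv_eq_top]; exact mul_ne_zero H.c0 (hk0 _ ht))]
    refine setLIntegral_mono' measurableSet_Icc fun σ hσ => ?_
    unfold hh
    gcongr
    · refine le_trans ?_ (H.lower a σ (by linarith [hσ.1]) (by linarith [hσ.2]))
      simp only [k]
      gcongr
      exact hσ.1
    · exact hσ.2
  set M := ∫⁻ a, AA μ D G a ^ P ∂μ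
  set J := ∫⁻ σ in Icc t (2*t), ∫⁻ b in {b | D a b < 2 * t}, G (b, σ) ∂μ
  have hkt0 := hk0 t ht
  have hktt := hkt t
  have h5 : J ≤ (c * (k (1/18) * k t))⁻¹ * (C * (k 2 * k t) * (M / (c * (k (1 / 9) * k t))) ^ (1 / P) * (C * (k 7 * k t))) := by
    rw [← ENNReal.mul_le_iff_le_inv] 
    · exact h3
    · exact mul_ne_zero H.c0 (mul_ne_zero (hk0 _ (by norm_num)) hkt0)
    · exact ENNReal.mul_ne_top H.ct (ENNReal.mul_ne_top (hkt _) hktt)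
  have e6 : ENNReal.ofReal (t ^ (-(ν / P))) = ((k t)⁻¹) ^ (1 / P) := by
    simp only [k]
    rw [← ENNReal.ofReal_inv_of_pos (by positivity), ENNReal.ofReal_rpow_of_pos (by positivity),
      ← Real.rpow_neg ht.le, ← Real.rpow_mul ht.le]
    congr 2; ring
  refine (h4.trans (mul_le_mul_right h5 _)).trans (le_of_eq ?_)
  rw [e6]
  have hP' : 0 ≤ 1 / P := by positivity
  have inv1 : ∀ x y : ℝ≥0∞, x ≠ 0 → x ≠ ∞ → (x * y)⁻¹ = x⁻¹ * y⁻¹ := fun x y h h' =>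
    ENNReal.mul_inv (Or.inl h) (Or.inl h')
  rw [div_eq_mul_inv M, ← mul_assoc c, ← mul_assoc c,
    ENNReal.mul_rpow_of_nonneg _ _ hP', inv1 c _ H.c0 H.ct, 
    inv1 (c * k (1/18)) _ (mul_ne_zero H.c0 (hk0 _ (by norm_num))) (ENNReal.mul_ne_top H.ct (hkt _)),
    inv1 (c * k (1/9)) _ (mul_ne_zero H.c0 (hk0 _ (by norm_num))) (ENNReal.mul_ne_top H.ct (hkt _)),
    ENNReal.mul_rpow_of_nonneg _ _ hP']
  have hc : (k t)⁻¹ * k t = 1 := ENNReal.inv_mul_cancel hkt0 hktt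
  set u := (k t)⁻¹
  set v := u ^ (1/P)
  calc _ = (u * k t) * (u * k t) * (c⁻¹ * ((c * k (1/18))⁻¹ * ((C * k 2) * ((c * k (1/9))⁻¹) ^ (1 / P) * (C * k 7))) * v * M ^ (1/P)) := by ring
    _ = _ := by rw [hc]; ring


lemma hedberg (H : QM μ D ν c C) (hν : 0 < ν) {P β : ℝ} (hP : 0 < P) (hβ : 0 ≤ β)
    (hβ' : β < ν / P) :
    ∃ C2 : ℝ≥0∞, C2 ≠ ∞ ∧ ∀ G : X × ℝ → ℝ≥0∞, Measurable G →
      (∀ b σ, 3 < σ → G (b, σ) = 0) → ∀ T, 0 < T → ∀ a,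
      ∫⁻ σ in Ioi 0, hh μ D G a σ * ENNReal.ofReal (σ ^ β) ≤
        ENNReal.ofReal (T ^ β) * AA μ D G a +
        C2 * ENNReal.ofReal (T ^ (β - ν / P)) * (∫⁻ a, AA μ D G a ^ P ∂μ) ^ (1 / P) := by
  obtain ⟨C1, hC1, h1⟩ := window H hν hP
  set γ := β - ν / P with hγ
  have hγ0 : γ < 0 := by linarith
  set r := ENNReal.ofReal ((2:ℝ) ^ γ) with hr
  have hr1 : r < 1 := by
    rw [hr, ENNReal.ofReal_lt_one]
    exact Real.rpow_lt_one_of_one_lt_of_neg (by norm_num) hγ0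
  refine ⟨C1 * ENNReal.ofReal (2 ^ β) * (1 - r)⁻¹, ?_, ?_⟩
  · refine ENNReal.mul_ne_top (ENNReal.mul_ne_top hC1 (by simp)) ?_
    simp only [ne_eq, ENNReal.inv_eq_top, tsub_eq_zero_iff_le, not_le]; exact hr1
  intro G hG hG0 T hT a
  set m := (∫⁻ a, AA μ D G a ^ P ∂μ) ^ (1 / P)
  have hm : Measurable fun σ => hh μ D G a σ := meas_hhr μ H.meas hG a
  have hsub : Ioi (0:ℝ) ⊆ Ioo 0 T ∪ ⋃ j : ℕ, Icc (2 ^ j * T) (2 * (2 ^ j * T)) := by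
    intro σ hσ
    have hσ : 0 < σ := hσ
    by_cases h : σ < T
    · exact Or.inl ⟨hσ, h⟩
    right
    push Not at h
    obtain ⟨j, hj1, hj2⟩ := exists_nat_pow_near (x := σ / T) (y := (2:ℝ)) ((one_le_div hT).2 h) (by norm_num)
    rw [mem_iUnion]
    refine ⟨j, (le_div_iff₀ hT).1 hj1, ?_⟩
    have := (div_lt_iff₀ hT).1 hj2
    rw [pow_succ] at this
    nlinarith
  calc ∫⁻ σ in Ioi 0, hh μ D G a σ * ENNReal.ofReal (σ ^ β)
      ≤ ∫⁻ σ in Ioo 0 T ∪ ⋃ j : ℕ, Icc (2 ^ j * T) (2 * (2 ^ j * T)), hh μ D G a σ * ENNReal.ofReal (σ ^ β) :=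
        lintegral_mono_set hsub
    _ ≤ (∫⁻ σ in Ioo 0 T, hh μ D G a σ * ENNReal.ofReal (σ ^ β)) +
        ∫⁻ σ in ⋃ j : ℕ, Icc (2 ^ j * T) (2 * (2 ^ j * T)), hh μ D G a σ * ENNReal.ofReal (σ ^ β) :=
        lintegral_union_le _ _ _
    _ ≤ ENNReal.ofReal (T ^ β) * AA μ D G a +
        ∑' j : ℕ, ∫⁻ σ in Icc (2 ^ j * T) (2 * (2 ^ j * T)), hh μ D G a σ * ENNReal.ofReal (σ ^ β) := by
        gcongr
        · rw [AA, ← lintegral_const_mul _ hm]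
          refine le_trans ?_ (lintegral_mono_set (s := Ioo 0 T) Ioo_subset_Ioi_self)
          refine setLIntegral_mono' measurableSet_Ioo fun σ hσ => ?_
          rw [mul_comm]
          gcongr
          · exact hσ.1.le
          · exact hσ.2.le
        · exact lintegral_iUnion_le _ _
    _ ≤ ENNReal.ofReal (T ^ β) * AA μ D G a +
        ∑' j : ℕ, (C1 * ENNReal.ofReal (2 ^ β) * ENNReal.ofReal (T ^ γ) * m) * r ^ j := by
        gcongr with j
        set t := (2:ℝ) ^ j * T with htdef
        have ht : 0 < t := by positivity
        calc ∫⁻ σ in Icc t (2 * t), hh μ D G a σ * ENNReal.ofReal (σ ^ β)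
            ≤ ∫⁻ σ in Icc t (2 * t), hh μ D G a σ * ENNReal.ofReal ((2 * t) ^ β) := by
              refine setLIntegral_mono' measurableSet_Icc fun σ hσ => ?_
              gcongr
              · linarith [hσ.1]
              · exact hσ.2
          _ = (∫⁻ σ in Icc t (2 * t), hh μ D G a σ) * ENNReal.ofReal ((2 * t) ^ β) :=
              lintegral_mul_const _ hm
          _ ≤ (C1 * ENNReal.ofReal (t ^ (-(ν / P))) * m) * ENNReal.ofReal ((2 * t) ^ β) := by
              gcongr; exact h1 G hG hG0 t ht a
          _ = (C1 * ENNReal.ofReal (2 ^ β) * m) * (ENNReal.ofReal (t ^ (-(ν / P))) * ENNReal.ofReal (t ^ β)) := by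
              rw [ofReal_rpow_scale 2 t β (by norm_num) ht]; ring
          _ = (C1 * ENNReal.ofReal (2 ^ β) * m) * (ENNReal.ofReal (T ^ γ) * r ^ j) := by
              congr 1
              rw [← ENNReal.ofReal_mul (by positivity), ← Real.rpow_add ht, hr,
                ← ENNReal.ofReal_pow (by positivity), ← ENNReal.ofReal_mul (by positivity)]
              congr 1
              rw [show -(ν / P) + β = γ by rw [hγ]; ring, htdef, Real.mul_rpow (by positivity) hT.le,
                ← Real.rpow_natCast, ← Real.rpow_natCast, ← Real.rpow_mul (by norm_num), ← Real.rpow_mul (by norm_num), mul_comm (j:ℝ) γ]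
              ring
          _ = _ := by ring
    _ = _ := by
        rw [ENNReal.tsum_mul_left, ENNReal.tsum_geometric]
        congr 1; ring

lemma AB_zero (H : QM μ D ν c C) {G : X × ℝ → ℝ≥0∞} (hG : Measurable G) (β : ℝ) (a : X)
    (ha : AA μ D G a = 0) : ∫⁻ σ in Ioi 0, hh μ D G a σ * ENNReal.ofReal (σ ^ β) = 0 := by
  have hm : Measurable fun σ => hh μ D G a σ := meas_hhr μ H.meas hG a
  have h := (lintegral_eq_zero_iff hm).1 ha
  rw [lintegral_congr_ae (g := fun _ => 0)]
  · simp
  · filter_upwards [h] with σ hσ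
    simp only [Pi.zero_apply] at hσ
    simp [hσ]

lemma real_opt {x y P P1 ν : ℝ} (hx : 0 < x) (hy : 0 < y) (hP : 0 < P) (hP1 : 0 < P1) (hν : 0 < ν) :
    ((y / x) ^ (P / ν)) ^ (ν * (1 / P - 1 / P1)) * x = x ^ (P / P1) * y ^ (1 - P / P1) ∧
    ((y / x) ^ (P / ν)) ^ (ν * (1 / P - 1 / P1) - ν / P) * y = x ^ (P / P1) * y ^ (1 - P / P1) := by
  have hyx : 0 < y / x := by positivity
  rw [← Real.rpow_mul hyx.le, ← Real.rpow_mul hyx.le]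
  have hPi : P * P⁻¹ = 1 := mul_inv_cancel₀ hP.ne'
  have hνi : ν * ν⁻¹ = 1 := mul_inv_cancel₀ hν.ne'
  have e1 : P / ν * (ν * (1 / P - 1 / P1)) = 1 - P / P1 := by
    simp only [div_eq_mul_inv, one_mul]
    linear_combination (P * P⁻¹ - P * P1⁻¹) * hνi + hPi
  have e2 : P / ν * (ν * (1 / P - 1 / P1) - ν / P) = - (P / P1) := by
    simp only [div_eq_mul_inv, one_mul]
    linear_combination (- P * P1⁻¹) * hνi
  rw [e1, e2, Real.div_rpow hy.le hx.le, Real.div_rpow hy.le hx.le, Real.rpow_sub hx, Real.rpow_sub hy,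
    Real.rpow_neg hx.le, Real.rpow_neg hy.le, Real.rpow_one, Real.rpow_one]
  have hu : 0 < x ^ (P / P1) := by positivity
  have hv : 0 < y ^ (P / P1) := by positivity
  generalize x ^ (P / P1) = u at *
  generalize y ^ (P / P1) = v at *
  constructor <;> field_simp

lemma embed (H : QM μ D ν c C) (hν : 0 < ν) {P P1 : ℝ} (hP : 0 < P) (hPP : P < P1) :
    ∃ C3 : ℝ≥0∞, C3 ≠ ∞ ∧ ∀ G : X × ℝ → ℝ≥0∞, Measurable G →
      (∀ b σ, 3 < σ → G (b, σ) = 0) →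
      (∫⁻ a, (∫⁻ σ in Ioi 0, hh μ D G a σ * ENNReal.ofReal (σ ^ (ν * (1 / P - 1 / P1)))) ^ P1 ∂μ) ^ (1 / P1)
        ≤ C3 * (∫⁻ a, AA μ D G a ^ P ∂μ) ^ (1 / P) := by
  have hP1 : 0 < P1 := hP.trans hPP
  have hinv : 1 / P1 < 1 / P := one_div_lt_one_div_of_lt hP hPP
  set β := ν * (1 / P - 1 / P1) with hβ
  have hb0 : 0 ≤ β := mul_nonneg hν.le (by linarith)
  have hb1 : β < ν / P := by
    rw [hβ, mul_sub, mul_one_div]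
    have : 0 < ν * (1 / P1) := by positivity
    linarith
  obtain ⟨C2, hC2, h2⟩ := hedberg H hν hP hb0 hb1
  refine ⟨1 + C2, by simp [hC2], ?_⟩
  intro G hG hG0
  set M := ∫⁻ a, AA μ D G a ^ P ∂μ with hM
  set m := M ^ (1 / P) with hm
  have hmM : m ^ P = M := by
    rw [hm, ← ENNReal.rpow_mul, one_div_mul_cancel hP.ne', ENNReal.rpow_one]
  by_cases hmt : m = ∞
  · rw [hmt, ENNReal.mul_top (by simp)]; exact le_top
  have hMt : M ≠ ∞ := by rw [← hmM]; exact ENNReal.rpow_ne_top_of_nonneg hP.le hmt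
  have hAm := (meas_AA μ H.meas hG).pow_const P
  have hpt : ∀ᵐ a ∂μ, (∫⁻ σ in Ioi 0, hh μ D G a σ * ENNReal.ofReal (σ ^ β)) ^ P1 ≤
      (1 + C2) ^ P1 * (AA μ D G a ^ P * m ^ (P1 - P)) := by
    by_cases hm0 : m = 0
    · have hM0 : M = 0 := by rw [← hmM, hm0, ENNReal.zero_rpow_of_pos hP]
      have := (lintegral_eq_zero_iff hAm).1 hM0
      filter_upwards [this] with a ha
      simp only [Pi.zero_apply, ENNReal.rpow_eq_zero_iff] at ha
      have ha' : AA μ D G a = 0 := by rcases ha with h | h; exact h.1; linarith [h.2]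
      rw [AB_zero H hG β a ha', ENNReal.zero_rpow_of_pos hP1]; exact zero_le
    · filter_upwards [ae_lt_top hAm hMt] with a ha
      by_cases h0 : AA μ D G a = 0
      · rw [AB_zero H hG β a h0, ENNReal.zero_rpow_of_pos hP1]; exact zero_le
      have hAt : AA μ D G a ≠ ∞ := by
        intro h; rw [h, ENNReal.top_rpow_of_pos hP] at ha; exact lt_irrefl _ ha
      set A := AA μ D G a with hA
      have hx : 0 < A.toReal := ENNReal.toReal_pos h0 hAt
      have hy : 0 < m.toReal := ENNReal.toReal_pos hm0 hmt
      have hAe : A = ENNReal.ofReal A.toReal := (ENNReal.ofReal_toReal hAt).symm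
      have hme : m = ENNReal.ofReal m.toReal := (ENNReal.ofReal_toReal hmt).symm
      obtain ⟨o1, o2⟩ := real_opt hx hy hP hP1 hν
      have hT : 0 < (m.toReal / A.toReal) ^ (P / ν) := by positivity
      have key := h2 G hG hG0 _ hT a
      rw [← hM, ← hm, ← hA] at key
      have k1 : ENNReal.ofReal (((m.toReal / A.toReal) ^ (P / ν)) ^ β) * A = A ^ (P / P1) * m ^ (1 - P / P1) := by
        conv_lhs => rw [hAe]
        conv_rhs => rw [hAe, hme]
        rw [ENNReal.ofReal_rpow_of_pos hx, ENNReal.ofReal_rpow_of_pos hy, ← ENNReal.ofReal_mul (by positivity),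
          ← ENNReal.ofReal_mul (by positivity), ENNReal.toReal_ofReal hx.le, o1]
      have k2 : ENNReal.ofReal (((m.toReal / A.toReal) ^ (P / ν)) ^ (β - ν / P)) * m = A ^ (P / P1) * m ^ (1 - P / P1) := by
        conv_lhs => rw [hme]
        conv_rhs => rw [hAe, hme]
        rw [ENNReal.ofReal_rpow_of_pos hx, ENNReal.ofReal_rpow_of_pos hy, ← ENNReal.ofReal_mul (by positivity),
          ← ENNReal.ofReal_mul (by positivity), ENNReal.toReal_ofReal hy.le, o2]
      rw [mul_assoc C2, k1, k2] at key
      calc _ ≤ ((1 + C2) * (A ^ (P / P1) * m ^ (1 - P / P1))) ^ P1 := by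
            refine ENNReal.rpow_le_rpow (key.trans (le_of_eq (by ring))) hP1.le
        _ = _ := by
            rw [ENNReal.mul_rpow_of_nonneg _ _ hP1.le, ENNReal.mul_rpow_of_nonneg _ _ hP1.le,
              ← ENNReal.rpow_mul, ← ENNReal.rpow_mul, div_mul_cancel₀ _ hP1.ne', sub_mul, div_mul_cancel₀ _ hP1.ne', one_mul]
  have hfin : ∫⁻ a, (∫⁻ σ in Ioi 0, hh μ D G a σ * ENNReal.ofReal (σ ^ β)) ^ P1 ∂μ ≤ ((1 + C2) * m) ^ P1 := by
    calc _ ≤ ∫⁻ a, (1 + C2) ^ P1 * (AA μ D G a ^ P * m ^ (P1 - P)) ∂μ := lintegral_mono_ae hpt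
      _ = (1 + C2) ^ P1 * (M * m ^ (P1 - P)) := by
        rw [lintegral_const_mul _ (hAm.mul_const _), lintegral_mul_const _ hAm]
      _ = _ := by
        rw [ENNReal.mul_rpow_of_nonneg _ _ hP1.le, ← hmM, ← ENNReal.rpow_add_of_nonneg _ _ hP.le (by linarith)]
        congr 2; ring
  calc _ ≤ (((1 + C2) * m) ^ P1) ^ (1 / P1) := ENNReal.rpow_le_rpow hfin (by positivity)
    _ = _ := by rw [← ENNReal.rpow_mul, mul_one_div_cancel hP1.ne', ENNReal.rpow_one]

lemma carl (H : QM μ D ν c C) (hν : 0 < ν) {P : ℝ} (hP : 1 ≤ P) :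
    ∃ C4 : ℝ≥0∞, C4 ≠ ∞ ∧ ∀ G : X × ℝ → ℝ≥0∞, Measurable G →
      (∀ b σ, 3 < σ → G (b, σ) = 0) → ∀ (B : Set X) (T : Set (X × ℝ)), MeasurableSet B →
      MeasurableSet T → (∀ q ∈ T, 0 < q.2 ∧ {x | D q.1 x < q.2} ⊆ B) →
      ∫⁻ q in T, G q * ENNReal.ofReal (q.2 ^ (ν / P)) ∂(μ.prod volume)
        ≤ μ B * (C4 * (∫⁻ a, AA μ D G a ^ P ∂μ) ^ (1 / P)) := by
  have hP0 : 0 < P := by linarith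
  set k := ENNReal.ofReal ((1/2 : ℝ) ^ ν) with hk
  have hk0 : k ≠ 0 := by simp [hk]; positivity
  have hkt : k ≠ ∞ := by simp [hk]
  set δ := (c * k) * C⁻¹ with hδ
  have hδ0 : δ ≠ 0 := mul_ne_zero (mul_ne_zero H.c0 hk0) (by simpa using H.Ct)
  have hδt : δ ≠ ∞ := ENNReal.mul_ne_top (ENNReal.mul_ne_top H.ct hkt) (by simpa using H.C0)
  refine ⟨(c⁻¹) ^ (1 / P) * δ⁻¹, ?_, ?_⟩
  · refine ENNReal.mul_ne_top (ENNReal.rpow_ne_top_of_nonneg (by positivity) (by simpa using H.c0)) (by simpa using hδ0)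
  intro G hG hG0 B T hB hT hTB
  set M := ∫⁻ a, AA μ D G a ^ P ∂μ with hM
  have hAm := meas_AA μ H.meas hG
  -- first reduction
  have s1 : ∫⁻ q in T, G q * ENNReal.ofReal (q.2 ^ (ν / P)) ∂(μ.prod volume) ≤
      (∫⁻ q in T, G q ∂(μ.prod volume)) * (c⁻¹ * μ B) ^ (1 / P) := by
    rw [← lintegral_mul_const _ hG]
    refine setLIntegral_mono' hT fun q hq => ?_
    by_cases h3 : 3 < q.2
    · rw [show G q = 0 from hG0 q.1 q.2 h3]; simp
    push Not at h3
    obtain ⟨hq0, hqB⟩ := hTB q hq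
    gcongr
    have e : ENNReal.ofReal (q.2 ^ (ν / P)) = ENNReal.ofReal (q.2 ^ ν) ^ (1 / P) := by
      rw [ENNReal.ofReal_rpow_of_pos (by positivity), ← Real.rpow_mul hq0.le, mul_one_div]
    rw [e]
    gcongr
    rw [← ENNReal.mul_le_iff_le_inv H.c0 H.ct]
    exact (H.lower q.1 q.2 hq0 (by linarith)).trans (measure_mono hqB)
  -- Fubini
  have s2 : δ * ∫⁻ q in T, G q ∂(μ.prod volume) ≤ ∫⁻ a in B, AA μ D G a ∂μ := by
    unfold AA
    rw [lintegral_lintegral_swap (meas_hh μ H.meas hG).aemeasurable, ← lintegral_indicator hT,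
      lintegral_prod_symm _ (hG.indicator hT).aemeasurable, ← lintegral_const_mul' _ _ hδt,
      ← lintegral_indicator measurableSet_Ioi]
    refine lintegral_mono fun σ => ?_
    by_cases hσ : 0 < σ
    swap
    · have : ∀ b, T.indicator G (b, σ) = 0 := fun b => by
        rw [indicator_of_notMem]; intro h; exact hσ (hTB _ h).1
      simp [this]
    rw [indicator_of_mem (show σ ∈ Ioi 0 from hσ)]
    by_cases h3 : 3 < σ
    · have : ∀ b, T.indicator G (b, σ) = 0 := fun b => by
        by_cases hb : (b, σ) ∈ T
        · rw [indicator_of_mem hb, hG0 b σ h3]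
        · rw [indicator_of_notMem hb]
      simp [this]
    push Not at h3
    set v := ENNReal.ofReal (σ ^ ν) with hv
    have hv0 : v ≠ 0 := by simp [hv]; positivity
    have hvt : v ≠ ∞ := by simp [hv]
    have hGs : Measurable fun b => G (b, σ) := hG.comp (measurable_id.prodMk measurable_const)
    have hS : MeasurableSet {q : X × X | D q.1 q.2 < σ} := measurableSet_lt H.meas measurable_const
    calc δ * ∫⁻ b, T.indicator G (b, σ) ∂μ
        = ∫⁻ b, δ * T.indicator G (b, σ) ∂μ := by rw [lintegral_const_mul' _ _ hδt]
      _ ≤ ∫⁻ b, (C * v)⁻¹ * ((μ.restrict B) {a | D a b < σ} * G (b, σ)) ∂μ := by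
          refine lintegral_mono fun b => ?_
          by_cases hb : (b, σ) ∈ T
          swap
          · rw [indicator_of_notMem hb]; simp
          rw [indicator_of_mem hb, ← mul_assoc]
          gcongr
          have hl : c * (k * v) ≤ (μ.restrict B) {a | D a b < σ} := by
            rw [hk, hv, ← ofReal_rpow_scale _ _ _ (by norm_num) hσ]
            refine (H.lower b _ (by positivity) (by linarith)).trans ?_
            rw [Measure.restrict_apply (meas_ball' H.meas _ _)]
            refine measure_mono fun x hx => ?_
            simp only [mem_ofPred_eq] at hx
            refine ⟨?_, (hTB _ hb).2 ?_⟩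
            · have := H.symm b x
              simp only [mem_ofPred_eq]; linarith
            · simp only [mem_ofPred_eq]; linarith
          calc δ = (C * v)⁻¹ * (c * (k * v)) := by
                rw [hδ, ENNReal.mul_inv (Or.inl H.C0) (Or.inl H.Ct)]
                calc _ = (v⁻¹ * v) * (c * k * C⁻¹) := by rw [ENNReal.inv_mul_cancel hv0 hvt, one_mul]
                  _ = _ := by ring
            _ ≤ _ := by gcongr
      _ = (C * v)⁻¹ * ∫⁻ b, (μ.restrict B) {a | D a b < σ} * G (b, σ) ∂μ := by
          rw [lintegral_const_mul]
          exact (measurable_measure_prodMk_right hS).mul hGs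
      _ = (C * v)⁻¹ * ∫⁻ b, ∫⁻ a in B, {q : X × X | D q.1 q.2 < σ}.indicator (fun q => G (q.2, σ)) (a, b) ∂μ ∂μ := by
          congr 1
          refine lintegral_congr fun b => ?_
          have : ∀ a, {q : X × X | D q.1 q.2 < σ}.indicator (fun q => G (q.2, σ)) (a, b) =
            {a | D a b < σ}.indicator (fun _ => G (b, σ)) a := fun a => rfl
          simp_rw [this]
          rw [lintegral_indicator (meas_ball' H.meas _ _), setLIntegral_const, mul_comm]
      _ = (C * v)⁻¹ * ∫⁻ a in B, ∫⁻ b, {q : X × X | D q.1 q.2 < σ}.indicator (fun q => G (q.2, σ)) (a, b) ∂μ ∂μ := by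
          congr 1
          rw [lintegral_lintegral_swap]
          exact (((hGs.comp measurable_snd).indicator hS).comp measurable_swap).aemeasurable
      _ = ∫⁻ a in B, (C * v)⁻¹ * ∫⁻ b, {q : X × X | D q.1 q.2 < σ}.indicator (fun q => G (q.2, σ)) (a, b) ∂μ ∂μ := by
          rw [lintegral_const_mul' _ _ (by
            simp only [ne_eq, ENNReal.inv_eq_top]; exact mul_ne_zero H.C0 hv0)]
      _ ≤ ∫⁻ a in B, hh μ D G a σ ∂μ := by
          refine lintegral_mono fun a => ?_
          unfold hh
          refine mul_le_mul' (ENNReal.inv_le_inv.2 (H.upper a σ hσ (by linarith))) (le_of_eq ?_)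
          rw [← lintegral_indicator (meas_ball H.meas _ _)]
          rfl
  -- Hoelder
  have s3 : ∫⁻ a in B, AA μ D G a ∂μ ≤ M ^ (1 / P) * μ B ^ (1 - 1 / P) := by
    rcases hP.eq_or_lt with h | h
    · rw [← h, hM, ← h]; simp [setLIntegral_le_lintegral]
    · have hc : P.HolderConjugate (P / (P - 1)) := Real.HolderConjugate.conjExponent h
      have := ENNReal.lintegral_mul_le_Lp_mul_Lq (μ.restrict B) hc hAm.aemeasurable
        (aemeasurable_const (b := (1 : ℝ≥0∞)))
      simp only [Pi.mul_apply, mul_one, ENNReal.one_rpow, lintegral_const, one_mul,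
        Measure.restrict_apply_univ] at this
      refine this.trans ?_
      have e : 1 / (P / (P - 1)) = 1 - 1 / P := by field_simp
      rw [e]
      gcongr
      exact setLIntegral_le_lintegral _ _
  have s4 : ∫⁻ q in T, G q ∂(μ.prod volume) ≤ δ⁻¹ * (M ^ (1 / P) * μ B ^ (1 - 1 / P)) := by
    rw [← ENNReal.mul_le_iff_le_inv hδ0 hδt]; exact s2.trans s3
  have hP1 : 0 ≤ 1 - 1 / P := by
    have : 1 / P ≤ 1 := by rw [div_le_one hP0]; exact hP
    linarith
  calc _ ≤ _ := s1
    _ ≤ (δ⁻¹ * (M ^ (1 / P) * μ B ^ (1 - 1 / P))) * (c⁻¹ * μ B) ^ (1 / P) := by gcongr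
    _ = (μ B ^ (1 / P) * μ B ^ (1 - 1 / P)) * (((c⁻¹) ^ (1 / P) * δ⁻¹) * M ^ (1 / P)) := by
      rw [ENNReal.mul_rpow_of_nonneg _ _ (by positivity)]; ring
    _ = _ := by
      rw [← ENNReal.rpow_add_of_nonneg _ _ (by positivity) hP1]; simp

end abstractPart

section geometry

def slab {n : ℕ} (ω : En n) (p q h : ℝ) : Set (En n) :=
  {z | inner ℝ ω z ∈ Ioo p q ∧ ‖z - (inner ℝ ω z : ℝ) • ω‖ < h}

lemma slab_vol (m : ℕ) (ω : En (m+1)) (hω : ‖ω‖ = 1) (p q h : ℝ) (hh0 : 0 < h) :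
    volume (slab ω p q h) ≤ ENNReal.ofReal (q - p) * ENNReal.ofReal (2 * h) ^ m ∧
    ENNReal.ofReal (q - p) * ENNReal.ofReal (2 * (h / (m + 1))) ^ m ≤ volume (slab ω p q h) := by
  obtain ⟨e, he⟩ : ∃ e : OrthonormalBasis (Fin (m+1)) ℝ (En (m+1)), e 0 = ω := by
    have := Orthonormal.exists_orthonormalBasis_extension_of_card_eq (𝕜 := ℝ) (E := En (m+1))
      (ι := Fin (m+1)) (by simp) (v := fun _ => ω) (s := {0}) (by
        constructor
        · rintro ⟨i, hi⟩; simpa using hω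
        · rintro ⟨i, hi⟩ ⟨j, hj⟩ hij
          simp only [mem_singleton_iff] at hi hj
          exact absurd (by simp [hi, hj]) hij)
    obtain ⟨b, hb⟩ := this
    exact ⟨b, hb 0 (by simp)⟩
  have hmp : MeasurePreserving (fun f : Fin (m+1) → ℝ => e.repr.symm (WithLp.toLp 2 f)) volume volume :=
    e.measurePreserving_repr_symm.comp (PiLp.volume_preserving_toLp _)
  have hSm : MeasurableSet (slab ω p q h) := by
    apply IsOpen.measurableSet
    have : slab ω p q h = (fun z : En (m+1) => (inner ℝ ω z : ℝ)) ⁻¹' Ioo p q ∩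
      {z | ‖z - (inner ℝ ω z : ℝ) • ω‖ < h} := rfl
    rw [this]
    refine (isOpen_Ioo.preimage (by fun_prop)).inter (isOpen_lt (by fun_prop) continuous_const)
  rw [← hmp.measure_preimage hSm.nullMeasurableSet]
  have hc : ∀ (f : Fin (m+1) → ℝ) i, inner ℝ (e i) (e.repr.symm (WithLp.toLp 2 f)) = f i := by
    intro f i
    rw [← e.repr_apply_apply, LinearIsometryEquiv.apply_symm_apply]
  have hn : ∀ f : Fin (m+1) → ℝ, ‖e.repr.symm (WithLp.toLp 2 f) - (inner ℝ ω (e.repr.symm (WithLp.toLp 2 f)) : ℝ) • ω‖ ^ 2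
      = ∑ i : Fin m, f i.succ ^ 2 := by
    intro f
    rw [← e.sum_sq_norm_inner_right, Fin.sum_univ_succ]
    have h0 : inner ℝ ω (e.repr.symm (WithLp.toLp 2 f)) = f 0 := by rw [← he, hc]
    have hin : ∀ i, inner ℝ (e i) ω = if i = 0 then (1:ℝ) else 0 := by
      intro i; rw [← he, e.inner_eq_ite]
    simp [inner_sub_right, inner_smul_right, hc, h0, hin]
  have hb : ∀ h : ℝ, volume (Set.pi univ (Fin.cons (Ioo p q) (fun _ : Fin m => Ioo (-h) h) : Fin (m+1) → Set ℝ)) =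
      ENNReal.ofReal (q - p) * ENNReal.ofReal (2 * h) ^ m := by
    intro h
    rw [volume_pi_pi, Fin.prod_univ_succ]
    simp only [Fin.cons_zero, Fin.cons_succ, Real.volume_Ioo, Finset.prod_const, Finset.card_univ, Fintype.card_fin]
    congr 3; ring
  rw [← hb, ← hb]
  constructor
  · refine measure_mono fun f hf => ?_
    obtain ⟨h1, h2⟩ := hf
    rw [← he, hc] at h1
    rw [mem_univ_pi]
    intro i
    refine Fin.cases ?_ (fun j => ?_) i
    · simpa using h1
    · simp only [Fin.cons_succ]
      have h3 := hn f
      have h4 : f j.succ ^ 2 ≤ ∑ i : Fin m, f i.succ ^ 2 :=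
        Finset.single_le_sum (f := fun i : Fin m => f i.succ ^ 2) (fun i _ => sq_nonneg _) (Finset.mem_univ j)
      rw [← h3] at h4
      have := abs_le.1 (abs_le_of_sq_le_sq h4 (norm_nonneg _))
      exact ⟨by linarith [this.1], by linarith [this.2]⟩
  · refine measure_mono fun f hf => ?_
    rw [mem_univ_pi] at hf
    have h0 : f 0 ∈ Ioo p q := hf 0
    have hj : ∀ j : Fin m, f j.succ ∈ Ioo (-(h / (m+1))) (h / (m+1)) := fun j => hf j.succ
    refine ⟨by rw [← he, hc]; exact h0, ?_⟩
    refine lt_of_pow_lt_pow_left₀ 2 hh0.le ?_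
    rw [hn]
    have hm1 : (0:ℝ) < m + 1 := by positivity
    calc ∑ i : Fin m, f i.succ ^ 2 ≤ ∑ i : Fin m, (h / (m+1)) ^ 2 := by
          refine Finset.sum_le_sum fun i _ => ?_
          exact sq_le_sq' (hj i).1.le (hj i).2.le
      _ = m * (h / (m+1)) ^ 2 := by simp
      _ < h ^ 2 := by
          rw [div_pow, ← mul_div_assoc, div_lt_iff₀ (by positivity)]
          have : 0 < h ^ 2 := by positivity
          have hm0 : (0:ℝ) ≤ m := by positivity
          nlinarith [mul_nonneg hm0 this.le, mul_nonneg (mul_nonneg hm0 hm0) this.le]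

lemma proj_sq {n : ℕ} (ω z : En n) (hω : ‖ω‖ = 1) :
    ‖z - (inner ℝ ω z : ℝ) • ω‖ ^ 2 = ‖z‖ ^ 2 - (inner ℝ ω z : ℝ) ^ 2 := by
  rw [norm_sub_sq_real, inner_smul_right, norm_smul, hω, real_inner_comm z ω, Real.norm_eq_abs, mul_one, sq_abs]
  ring

def DD {n : ℕ} (a b : CoSph n) : ℝ :=
  |inner ℝ (a.2 : En n) (a.1 - b.1)| + ‖a.1 - b.1‖ ^ 2 + ‖(a.2 : En n) - (b.2 : En n)‖ ^ 2

lemma DD_nonneg {n : ℕ} (a b : CoSph n) : 0 ≤ DD a b := by unfold DD; positivity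

lemma rball_sqrt {n : ℕ} (a : CoSph n) (σ : ℝ) : rball a (Real.sqrt σ) = {b | DD a b < σ} := by
  ext b
  exact Real.sqrt_lt_sqrt_iff (DD_nonneg a b)

lemma DD_cont {n : ℕ} : Continuous fun p : CoSph n × CoSph n => DD p.1 p.2 := by
  unfold DD; fun_prop

lemma DD_symm {n : ℕ} (a b : CoSph n) : DD b a ≤ 2 * DD a b := by
  obtain ⟨x, ω⟩ := a
  obtain ⟨y, v⟩ := b
  unfold DD
  simp only
  rw [norm_sub_rev y x, norm_sub_rev (v : En n) ω]
  have h1 : inner ℝ (v : En n) (y - x) = - inner ℝ (ω : En n) (x - y) + inner ℝ ((ω : En n) - v) (x - y) := by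
    rw [inner_sub_left, ← neg_sub x y, inner_neg_right]; ring
  have h2 := abs_real_inner_le_norm ((ω : En n) - v) (x - y)
  have h3 : |inner ℝ (v : En n) (y - x)| ≤ |inner ℝ (ω : En n) (x - y)| + |inner ℝ ((ω : En n) - v) (x - y)| := by
    rw [h1]; refine (abs_add_le _ _).trans ?_; rw [abs_neg]
  nlinarith [sq_nonneg (‖(ω : En n) - v‖ - ‖x - y‖), abs_nonneg (inner ℝ (ω : En n) (x - y)), norm_nonneg (x - y), sq_nonneg ‖x - y‖, sq_nonneg ‖(ω : En n) - v‖]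

lemma DD_tri {n : ℕ} (a b d : CoSph n) : DD a d ≤ 3 * (DD a b + DD b d) := by
  obtain ⟨x, ω⟩ := a
  obtain ⟨y, v⟩ := b
  obtain ⟨z, u⟩ := d
  unfold DD
  simp only
  have h1 : inner ℝ (ω : En n) (x - z) = inner ℝ (ω : En n) (x - y) + inner ℝ (v : En n) (y - z) + inner ℝ ((ω : En n) - v) (y - z) := by
    rw [inner_sub_left, show x - z = (x - y) + (y - z) by abel, inner_add_right]; ring
  have h2 := abs_real_inner_le_norm ((ω : En n) - v) (y - z)
  have h3 : |inner ℝ (ω : En n) (x - z)| ≤ |inner ℝ (ω : En n) (x - y)| + |inner ℝ (v : En n) (y - z)| + |inner ℝ ((ω : En n) - v) (y - z)| := by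
    rw [h1]; exact abs_add_three _ _ _
  have h4 : ‖x - z‖ ≤ ‖x - y‖ + ‖y - z‖ := norm_sub_le_norm_sub_add_norm_sub _ _ _
  have h5 : ‖(ω : En n) - u‖ ≤ ‖(ω : En n) - v‖ + ‖(v : En n) - u‖ := norm_sub_le_norm_sub_add_norm_sub _ _ _
  have h6 : ‖x - z‖ ^ 2 ≤ 2 * ‖x - y‖ ^ 2 + 2 * ‖y - z‖ ^ 2 := by
    nlinarith [norm_nonneg (x - z), sq_nonneg (‖x - y‖ - ‖y - z‖), norm_nonneg (x-y), norm_nonneg (y-z)]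
  have h7 : ‖(ω : En n) - u‖ ^ 2 ≤ 2 * ‖(ω : En n) - v‖ ^ 2 + 2 * ‖(v : En n) - u‖ ^ 2 := by
    nlinarith [norm_nonneg ((ω : En n) - u), sq_nonneg (‖(ω : En n) - v‖ - ‖(v : En n) - u‖), norm_nonneg ((ω : En n) - v), norm_nonneg ((v : En n) - u)]
  nlinarith [sq_nonneg (‖(ω : En n) - v‖ - ‖y - z‖), abs_nonneg (inner ℝ (ω : En n) (x - y)),
    abs_nonneg (inner ℝ (v : En n) (y - z)), sq_nonneg ‖x - y‖, sq_nonneg ‖y - z‖, sq_nonneg ‖(ω : En n) - v‖, sq_nonneg ‖(v : En n) - u‖]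

def cap {n : ℕ} (ω : Sph n) (δ : ℝ) : Set (Sph n) := {v | ‖(ω : En n) - v‖ < δ}

lemma cap_meas {n : ℕ} (ω : Sph n) (δ : ℝ) : MeasurableSet (cap ω δ) :=
  (isOpen_lt (by fun_prop) continuous_const).measurableSet

lemma cap_upper (m : ℕ) (ω : Sph (m+1)) {δ : ℝ} (hδ : 0 < δ) :
    (volume : Measure (En (m+1))).toSphere (cap ω δ) ≤ (m+1 : ℕ) * (ENNReal.ofReal 2 * ENNReal.ofReal (2 * δ) ^ m) := by
  have hω : ‖(ω : En (m+1))‖ = 1 := by simp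
  rw [Measure.toSphere_apply' _ (cap_meas ω δ), finrank_euclideanSpace_fin]
  gcongr
  have := (slab_vol m ω hω (-1) 1 δ hδ).1
  rw [show (1 - -1 : ℝ) = 2 by norm_num] at this
  refine (measure_mono ?_).trans this
  rintro z ⟨r, ⟨hr0, hr1⟩, _, ⟨v, hv, rfl⟩, rfl⟩
  have hv1 : ‖(v : En (m+1))‖ = 1 := by simp
  have hv : ‖(ω : En (m+1)) - v‖ < δ := hv
  have hi : |inner ℝ (ω : En (m+1)) v| ≤ 1 := by
    have := abs_real_inner_le_norm (ω : En (m+1)) v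
    rwa [hω, hv1, one_mul] at this
  simp only [slab, mem_ofPred_eq, inner_smul_right]
  have hi' := abs_le.1 hi
  refine ⟨⟨by nlinarith, by nlinarith⟩, ?_⟩
  have e : r • (v : En (m+1)) - (r * inner ℝ (ω : En (m+1)) (v : En (m+1))) • (ω : En (m+1)) =
      r • (((v : En (m+1)) - ω) - (inner ℝ (ω : En (m+1)) ((v : En (m+1)) - ω) : ℝ) • (ω : En (m+1))) := by
    rw [inner_sub_right, real_inner_self_eq_norm_sq, hω]
    module
  rw [e, norm_smul, Real.norm_eq_abs, abs_of_pos hr0]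
  have h1 := proj_sq (ω : En (m+1)) ((v : En (m+1)) - ω) hω
  have h2 : ‖((v : En (m+1)) - ω) - (inner ℝ (ω : En (m+1)) ((v : En (m+1)) - ω) : ℝ) • (ω : En (m+1))‖ ≤ ‖(v : En (m+1)) - ω‖ := by
    refine (sq_le_sq₀ (norm_nonneg _) (norm_nonneg _)).1 ?_
    rw [h1]; linarith [sq_nonneg (inner ℝ (ω : En (m+1)) ((v : En (m+1)) - ω))]
  rw [norm_sub_rev] at hv
  nlinarith [norm_nonneg (((v : En (m+1)) - ω) - (inner ℝ (ω : En (m+1)) ((v : En (m+1)) - ω) : ℝ) • (ω : En (m+1)))]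

lemma cap_lower (m : ℕ) (ω : Sph (m+1)) {δ : ℝ} (hδ : 0 < δ) (hδ1 : δ ≤ 1) :
    (m+1 : ℕ) * (ENNReal.ofReal (1/4) * ENNReal.ofReal (2 * (δ / 8 / (m+1))) ^ m) ≤
    (volume : Measure (En (m+1))).toSphere (cap ω δ) := by
  have hω : ‖(ω : En (m+1))‖ = 1 := by simp
  rw [Measure.toSphere_apply' _ (cap_meas ω δ), finrank_euclideanSpace_fin]
  gcongr
  have := (slab_vol m ω hω (1/4) (1/2) (δ/8) (by positivity)).2
  rw [show (1/2 - 1/4 : ℝ) = 1/4 by norm_num] at this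
  refine this.trans (measure_mono ?_)
  rintro z ⟨⟨hz1, hz2⟩, hz3⟩
  have hp := proj_sq (ω : En (m+1)) z hω
  set i : ℝ := inner ℝ (ω : En (m+1)) z with hi
  set g := ‖z - i • (ω : En (m+1))‖ with hg
  have hg0 : 0 ≤ g := norm_nonneg _
  have hz4 : ‖z‖ < 1 := by nlinarith [norm_nonneg z]
  have hz5 : 1/4 < ‖z‖ := by nlinarith [norm_nonneg z]
  have hz0 : 0 < ‖z‖ := by linarith
  have hmem : (‖z‖⁻¹ • z) ∈ Metric.sphere (0 : En (m+1)) 1 := by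
    simp [norm_smul, hz0.ne']
  refine ⟨‖z‖, ⟨hz0, hz4⟩, ‖z‖⁻¹ • z, ⟨⟨_, hmem⟩, ?_, rfl⟩, ?_⟩
  · show ‖(ω : En (m+1)) - ‖z‖⁻¹ • z‖ < δ
    have e : (ω : En (m+1)) - ‖z‖⁻¹ • z = ‖z‖⁻¹ • (‖z‖ • (ω : En (m+1)) - z) := by
      rw [smul_sub, smul_smul, inv_mul_cancel₀ hz0.ne', one_smul]
    rw [e, norm_smul, norm_inv, norm_norm, inv_mul_lt_iff₀ hz0]
    have h1 : ‖‖z‖ • (ω : En (m+1)) - z‖ ≤ ‖(‖z‖ - i) • (ω : En (m+1))‖ + g := by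
      have : ‖z‖ • (ω : En (m+1)) - z = (‖z‖ - i) • (ω : En (m+1)) - (z - i • (ω : En (m+1))) := by module
      rw [this]; exact norm_sub_le _ _
    rw [norm_smul, hω, mul_one, Real.norm_eq_abs] at h1
    have h2 : |‖z‖ - i| ≤ g := by
      have := abs_norm_sub_norm_le z (i • (ω : En (m+1)))
      rwa [norm_smul, hω, mul_one, Real.norm_eq_abs, abs_of_pos (by linarith : 0 < i)] at this
    nlinarith
  · simp [smul_smul, hz0.ne']

instance (n : ℕ) : SFinite (muS n) := by
  unfold muS sphMeasure; infer_instance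

lemma subv (m : ℕ) (x : En (m+1)) (S : Set (En (m+1))) (hS : MeasurableSet S) : volume {y | x - y ∈ S} = volume S :=
  (Measure.measurePreserving_sub_left volume x).measure_preimage hS.nullMeasurableSet

lemma slab_meas {n : ℕ} (ω : En n) (p q h : ℝ) : MeasurableSet (slab ω p q h) := by
  apply IsOpen.measurableSet
  have : slab ω p q h = (fun z : En n => (inner ℝ ω z : ℝ)) ⁻¹' Ioo p q ∩
    {z | ‖z - (inner ℝ ω z : ℝ) • ω‖ < h} := rfl
  rw [this]
  refine (isOpen_Ioo.preimage (by fun_prop)).inter (isOpen_lt (by fun_prop) continuous_const)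

lemma muS_prod (m : ℕ) (A : Set (En (m+1))) (B : Set (Sph (m+1))) : muS (m+1) (A ×ˢ B) =
    ((volume : Measure (En (m+1))).toSphere Set.univ)⁻¹ * (volume A * (volume : Measure (En (m+1))).toSphere B) := by
  unfold muS sphMeasure
  rw [Measure.prod_prod, Measure.smul_apply, smul_eq_mul]; ring

lemma ball_vol (n : ℕ) (hn : 2 ≤ n) : ∃ c C : ℝ≥0∞, QM (muS n) DD n c C := by
  obtain ⟨m, rfl⟩ : ∃ m, n = m + 1 := ⟨n - 1, by omega⟩
  set c0 := ((volume : Measure (En (m+1))).toSphere Set.univ)⁻¹ with hc0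
  have c00 : c0 ≠ 0 := by simp only [hc0, ne_eq, ENNReal.inv_eq_zero]; exact measure_ne_top _ _
  have c0t : c0 ≠ ∞ := by
    simp only [hc0, ne_eq, ENNReal.inv_eq_top]
    rw [Measure.measure_univ_eq_zero]
    exact Measure.toSphere_ne_zero _
  have hm1 : ((m+1 : ℕ) : ℝ≥0∞) ≠ 0 := by simp
  set kl : ℝ := (2 * (1/20)) * (2 * (1/20/(m+1))) ^ m * ((1/4) * (2 * (1/20/8/(m+1))) ^ m) with hkl
  set ku : ℝ := 2 * 2 ^ m * (2 * 2 ^ m) with hku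
  have hklp : 0 < kl := by positivity
  have hkup : 0 < ku := by positivity
  have hsq : ∀ σ : ℝ, 0 < σ → σ ^ ((m+1 : ℕ) : ℝ) = σ * (Real.sqrt σ) ^ m * (Real.sqrt σ) ^ m := by
    intro σ hσ
    rw [Real.rpow_natCast, mul_assoc, ← mul_pow, Real.mul_self_sqrt hσ.le]; ring
  refine ⟨c0 * ((m+1 : ℕ) * ENNReal.ofReal kl), c0 * ((m+1 : ℕ) * ENNReal.ofReal ku), ?_⟩
  constructor
  · exact DD_cont.measurable
  · exact DD_symm
  · exact DD_tri
  · exact mul_ne_zero c00 (mul_ne_zero hm1 (by simpa using hklp))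
  · exact ENNReal.mul_ne_top c0t (ENNReal.mul_ne_top (by simp) (by simp))
  · exact mul_ne_zero c00 (mul_ne_zero hm1 (by simpa using hkup))
  · exact ENNReal.mul_ne_top c0t (ENNReal.mul_ne_top (by simp) (by simp))
  · rintro ⟨x, ω⟩ σ hσ hσ1
    have hω : ‖(ω : En (m+1))‖ = 1 := by simp
    set τ := Real.sqrt σ with hτ
    have hτ0 : 0 < τ := Real.sqrt_pos.2 hσ
    have hτ2 : τ ^ 2 = σ := Real.sq_sqrt hσ.le
    have hτ10 : τ ≤ 10 := by nlinarith
    have hsub : {y | x - y ∈ slab (ω : En (m+1)) (-(1/20*σ)) (1/20*σ) (1/20*τ)} ×ˢ cap ω (1/20*τ) ⊆ {b | DD (x, ω) b < σ} := by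
      rintro ⟨y, v⟩ ⟨⟨h1, h2⟩, h3⟩
      simp only at h1 h2
      have h3 : ‖(ω : En (m+1)) - v‖ < 1/20*τ := h3
      show |inner ℝ (ω : En (m+1)) (x - y)| + ‖x - y‖ ^ 2 + ‖(ω : En (m+1)) - v‖ ^ 2 < σ
      have hp := proj_sq (ω : En (m+1)) (x - y) hω
      have h4 : |inner ℝ (ω : En (m+1)) (x - y)| < 1/20*σ := abs_lt.2 h1
      have h5 : (inner ℝ (ω : En (m+1)) (x - y) : ℝ) ^ 2 < (1/20*σ) ^ 2 := sq_lt_sq' h1.1 h1.2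
      have h6 := pow_lt_pow_left₀ h2 (norm_nonneg _) (two_ne_zero)
      have h7 := pow_lt_pow_left₀ h3 (norm_nonneg _) (two_ne_zero)
      rw [mul_pow, hτ2] at h6 h7
      nlinarith
    refine le_trans ?_ (measure_mono hsub)
    rw [muS_prod, ← hc0, subv _ _ _ (slab_meas _ _ _ _), mul_assoc]
    have a1 := (slab_vol m ω hω (-(1/20*σ)) (1/20*σ) (1/20*τ) (by positivity)).2
    have a2 := cap_lower m ω (δ := 1/20*τ) (by positivity) (by linarith)
    refine mul_le_mul' le_rfl ?_
    refine le_trans (le_of_eq ?_) (mul_le_mul' a1 a2)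
    rw [← ENNReal.ofReal_pow (by positivity), ← ENNReal.ofReal_pow (by positivity),
      ← ENNReal.ofReal_mul (by linarith), ← ENNReal.ofReal_mul (by norm_num), mul_assoc,
      ← ENNReal.ofReal_mul (by positivity), mul_left_comm,
      ← ENNReal.ofReal_mul (mul_nonneg (by linarith) (by positivity))]
    congr 2
    rw [hsq σ hσ, hkl, ← hτ]
    rw [show 2 * (1/20*τ/(m+1:ℝ)) = (2 * (1/20/(m+1))) * τ by ring, show 2 * (1/20*τ/8/(m+1:ℝ)) = (2 * (1/20/8/(m+1))) * τ by ring]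
    generalize 2 * (1/20/(m+1:ℝ)) = u1
    generalize 2 * (1/20/8/(m+1:ℝ)) = u2
    rw [mul_pow, mul_pow]
    ring
  · rintro ⟨x, ω⟩ σ hσ hσ1
    have hω : ‖(ω : En (m+1))‖ = 1 := by simp
    set τ := Real.sqrt σ with hτ
    have hτ0 : 0 < τ := Real.sqrt_pos.2 hσ
    have hτ2 : τ ^ 2 = σ := Real.sq_sqrt hσ.le
    have hsub : {b | DD (x, ω) b < σ} ⊆ {y | x - y ∈ slab (ω : En (m+1)) (-σ) σ τ} ×ˢ cap ω τ := by
      rintro ⟨y, v⟩ h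
      have h : |inner ℝ (ω : En (m+1)) (x - y)| + ‖x - y‖ ^ 2 + ‖(ω : En (m+1)) - v‖ ^ 2 < σ := h
      have hp := proj_sq (ω : En (m+1)) (x - y) hω
      have p1 := abs_nonneg (inner ℝ (ω : En (m+1)) (x - y))
      have p2 := sq_nonneg ‖x - y‖
      have p3 := sq_nonneg ‖(ω : En (m+1)) - v‖
      have p4 := sq_nonneg (inner ℝ (ω : En (m+1)) (x - y))
      refine ⟨⟨abs_lt.1 (by linarith), ?_⟩, ?_⟩
      · exact lt_of_pow_lt_pow_left₀ 2 hτ0.le (by rw [hτ2]; simp only; linarith)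
      · exact lt_of_pow_lt_pow_left₀ 2 hτ0.le (by rw [hτ2]; simp only; linarith)
    refine (measure_mono hsub).trans ?_
    rw [muS_prod, ← hc0, subv _ _ _ (slab_meas _ _ _ _), mul_assoc]
    have a1 := (slab_vol m ω hω (-σ) σ τ (by positivity)).1
    have a2 := cap_upper m ω (δ := τ) (by positivity)
    refine mul_le_mul' le_rfl ?_
    refine le_trans (mul_le_mul' a1 a2) (le_of_eq ?_)
    rw [← ENNReal.ofReal_pow (by positivity),
      ← ENNReal.ofReal_mul (by linarith), ← ENNReal.ofReal_mul (by norm_num), mul_assoc,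
      ← ENNReal.ofReal_mul (by positivity), mul_left_comm,
      ← ENNReal.ofReal_mul (mul_nonneg (by linarith) (by positivity))]
    congr 2
    rw [hsq σ hσ, hku, ← hτ, mul_pow]
    ring

end geometry

section final

def GG {n : ℕ} (s : ℝ) (F : CoSph n × ℝ → ℂ) (q : CoSph n × ℝ) : ℝ≥0∞ :=
  (‖F q‖₊ : ℝ≥0∞) ^ (2 : ℝ) * ENNReal.ofReal (q.2 ^ (-(1 : ℝ) - 2 * s))

lemma GG_meas {n : ℕ} (s : ℝ) {F : CoSph n × ℝ → ℂ} (hF : Measurable F) : Measurable (GG s F) := by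
  unfold GG
  exact (hF.nnnorm.coe_nnreal_ennreal.pow_const _).mul
    ((measurable_snd.pow_const _).ennreal_ofReal)

lemma GG_zero {n : ℕ} (s : ℝ) {F : CoSph n × ℝ → ℂ}
    (h0 : ∀ q : CoSph n × ℝ, Real.exp 1 < q.2 → F q = 0) (b : CoSph n) (σ : ℝ) (hσ : 3 < σ) :
    GG s F (b, σ) = 0 := by
  have : F (b, σ) = 0 := h0 (b, σ) (by simp only; linarith [Real.exp_one_lt_d9])
  simp [GG, this]

lemma conAs_eq {n : ℕ} (s β : ℝ) {F : CoSph n × ℝ → ℂ} (hF : Measurable F) (a : CoSph n) :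
    conAs (s - β / 2) F a =
      (∫⁻ σ in Ioi (0:ℝ), hh (muS n) DD (GG s F) a σ * ENNReal.ofReal (σ ^ β)) ^ (1 / 2 : ℝ) := by
  unfold conAs
  congr 1
  refine setLIntegral_congr_fun measurableSet_Ioi fun σ hσ => ?_
  have hσ : 0 < σ := hσ
  have hm : Measurable fun b => (‖F (b, σ)‖₊ : ℝ≥0∞) ^ (2 : ℝ) :=
    (hF.comp (measurable_id.prodMk measurable_const)).nnnorm.coe_nnreal_ennreal.pow_const _
  unfold hh GG
  dsimp only
  rw [rball_sqrt, lintegral_mul_const _ hm,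
    show -(1:ℝ) - 2 * (s - β / 2) = (-1 - 2 * s) + β by ring, Real.rpow_add hσ,
    ENNReal.ofReal_mul (by positivity)]
  ring

lemma conAs_eq0 {n : ℕ} (s : ℝ) {F : CoSph n × ℝ → ℂ} (hF : Measurable F) (a : CoSph n) :
    conAs s F a = (AA (muS n) DD (GG s F) a) ^ (1 / 2 : ℝ) := by
  have := conAs_eq s 0 hF a
  simpa [AA] using this

lemma tentNorm_eq {n : ℕ} (p : ℝ≥0∞) (hp0 : 0 < p) (hp : p ≠ ∞) (s : ℝ) {F : CoSph n × ℝ → ℂ}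
    (hF : Measurable F) :
    tentNorm p s F = ((∫⁻ a, AA (muS n) DD (GG s F) a ^ (p.toReal / 2) ∂(muS n)) ^ (1 / (p.toReal / 2))) ^ (1 / 2 : ℝ) := by
  have hpp : 0 < p.toReal := ENNReal.toReal_pos hp0.ne' hp
  rw [tentNorm, if_neg hp, ← ENNReal.rpow_mul]
  congr 1
  · refine lintegral_congr fun a => ?_
    rw [conAs_eq0 s hF, ← ENNReal.rpow_mul]; congr 1; ring
  · field_simp

lemma emb_fin (n : ℕ) (hn : 2 ≤ n) (p₀ p₁ : ℝ≥0∞) (hp₀ : 0 < p₀)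
    (hp : p₀ ≤ p₁) (hp1 : p₁ ≠ ∞) (s : ℝ) :
    ∃ C : ℝ≥0∞, C ≠ ∞ ∧ ∀ F : CoSph n × ℝ → ℂ, Measurable F →
      (∀ q : CoSph n × ℝ, Real.exp 1 < q.2 → F q = 0) →
      tentNorm p₁ (s - (n : ℝ) * (p₀⁻¹.toReal - p₁⁻¹.toReal)) F ≤ C * tentNorm p₀ s F := by
  rcases hp.eq_or_lt with rfl | hlt
  · exact ⟨1, by simp, fun F _ _ => by simp⟩
  have hp0t : p₀ ≠ ∞ := ne_top_of_lt hlt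
  have hP0 : 0 < p₀.toReal := ENNReal.toReal_pos hp₀.ne' hp0t
  have hPP : p₀.toReal < p₁.toReal := (ENNReal.toReal_lt_toReal hp0t hp1).2 hlt
  have hP1 : 0 < p₁.toReal := hP0.trans hPP
  have hn0 : (0:ℝ) < n := by positivity
  obtain ⟨c, C, H⟩ := ball_vol n hn
  obtain ⟨C3, hC3, h3⟩ := embed H hn0 (P := p₀.toReal / 2) (P1 := p₁.toReal / 2) (by positivity) (by linarith)
  refine ⟨C3 ^ (1 / 2 : ℝ), ENNReal.rpow_ne_top_of_nonneg (by norm_num) hC3, fun F hF h0 => ?_⟩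
  have key := h3 (GG s F) (GG_meas s hF) (GG_zero s h0)
  rw [tentNorm_eq p₀ hp₀ hp0t s hF, ← ENNReal.mul_rpow_of_nonneg _ _ (by norm_num)]
  refine le_trans (le_of_eq ?_) (ENNReal.rpow_le_rpow key (by norm_num))
  rw [tentNorm, if_neg hp1, ← ENNReal.rpow_mul]
  congr 1
  · refine lintegral_congr fun a => ?_
    rw [show s - (n : ℝ) * (p₀⁻¹.toReal - p₁⁻¹.toReal) =
      s - ((n:ℝ) * (1 / (p₀.toReal / 2) - 1 / (p₁.toReal / 2))) / 2 by
        rw [ENNReal.toReal_inv, ENNReal.toReal_inv]; field_simp,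
      conAs_eq s _ hF, ← ENNReal.rpow_mul]
    congr 1; ring
  · field_simp

lemma DDq_cont {n : ℕ} (b : CoSph n) : Continuous fun q : CoSph n × ℝ => DD q.1 b := by
  unfold DD; fun_prop

lemma tent_eq {n : ℕ} (x : CoSph n) (r : ℝ) :
    tentOver x r = {q : CoSph n × ℝ | 0 < q.2} ∩
      (⋃ b ∈ (rball x r)ᶜ, {q : CoSph n × ℝ | DD q.1 b < q.2})ᶜ := by
  ext q
  have h : ∀ b, rho q.1 b < Real.sqrt q.2 ↔ DD q.1 b < q.2 :=
    fun b => Real.sqrt_lt_sqrt_iff (DD_nonneg _ _)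
  constructor
  · rintro ⟨h0, h1⟩
    refine ⟨h0, fun hq => ?_⟩
    obtain ⟨b, hb, hqb⟩ := mem_iUnion₂.1 hq
    exact hb (h1 b ((h b).2 hqb))
  · rintro ⟨h0, h1⟩
    refine ⟨h0, fun b hb => ?_⟩
    by_contra hc
    exact h1 (mem_iUnion₂.2 ⟨b, hc, (h b).1 hb⟩)

lemma tent_meas {n : ℕ} (x : CoSph n) (r : ℝ) : MeasurableSet (tentOver x r) := by
  rw [tent_eq]
  have h1 : IsOpen {q : CoSph n × ℝ | 0 < q.2} := isOpen_lt continuous_const continuous_snd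
  have h2 : IsOpen (⋃ b ∈ (rball x r)ᶜ, {q : CoSph n × ℝ | DD q.1 b < q.2}) :=
    isOpen_biUnion fun b _ => isOpen_lt (DDq_cont b) continuous_snd
  exact h1.measurableSet.inter h2.measurableSet.compl

lemma rball_meas {n : ℕ} (x : CoSph n) (r : ℝ) : MeasurableSet (rball x r) := by
  have h : Measurable fun b : CoSph n => rho x b :=
    (DD_cont.comp (continuous_const.prodMk continuous_id)).measurable.sqrt
  exact measurableSet_lt h measurable_const

lemma emb_top (n : ℕ) (hn : 2 ≤ n) (p : ℝ≥0∞) (hp2 : 2 ≤ p) (hp : p ≠ ∞) (s : ℝ) :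
    ∃ C : ℝ≥0∞, C ≠ ∞ ∧ ∀ F : CoSph n × ℝ → ℂ, Measurable F →
      (∀ q : CoSph n × ℝ, Real.exp 1 < q.2 → F q = 0) →
      tentNorm ∞ (s - (n : ℝ) * p⁻¹.toReal) F ≤ C * tentNorm p s F := by
  have hP2 : 2 ≤ p.toReal := by
    have := ENNReal.toReal_mono hp hp2
    simpa using this
  have hn0 : (0:ℝ) < n := by positivity
  obtain ⟨c, C, H⟩ := ball_vol n hn
  obtain ⟨C4, hC4, h4⟩ := carl H hn0 (P := p.toReal / 2) (by linarith)
  refine ⟨C4 ^ (1 / 2 : ℝ), ENNReal.rpow_ne_top_of_nonneg (by norm_num) hC4, fun F hF h0 => ?_⟩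
  rw [tentNorm_eq p (lt_of_lt_of_le (by norm_num) hp2) hp s hF, ← ENNReal.mul_rpow_of_nonneg _ _ (by norm_num),
    tentNorm, if_pos rfl]
  refine essSup_le_of_ae_le _ (Filter.Eventually.of_forall fun a => ?_)
  refine iSup_le fun x => iSup_le fun r => iSup_le fun hr => iSup_le fun ha => ?_
  refine ENNReal.rpow_le_rpow ?_ (by norm_num)
  have key := h4 (GG s F) (GG_meas s hF) (GG_zero s h0) (rball x r) (tentOver x r) (rball_meas x r) (tent_meas x r)
    (fun q hq => ⟨hq.1, fun b hb => hq.2 b ((Real.sqrt_lt_sqrt_iff (DD_nonneg _ _)).2 hb)⟩)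
  have e : ∫⁻ q in tentOver x r, (‖F q‖₊ : ℝ≥0∞) ^ (2 : ℝ) * ENNReal.ofReal (q.2 ^ (-(1 : ℝ) - 2 * (s - (n : ℝ) * p⁻¹.toReal)))
        ∂((muS n).prod (volume : Measure ℝ)) = ∫⁻ q in tentOver x r, GG s F q * ENNReal.ofReal (q.2 ^ ((n:ℝ) / (p.toReal / 2))) ∂((muS n).prod volume) := by
    refine setLIntegral_congr_fun (tent_meas x r) fun q hq => ?_
    have hq0 : 0 < q.2 := hq.1
    simp only [GG]
    rw [mul_assoc, ← ENNReal.ofReal_mul (by positivity), ← Real.rpow_add hq0, ENNReal.toReal_inv]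
    congr 3
    field_simp
    ring
  rw [e]
  set J := ∫⁻ q in tentOver x r, GG s F q * ENNReal.ofReal (q.2 ^ ((n:ℝ) / (p.toReal / 2))) ∂((muS n).prod volume)
  generalize muS n (rball x r) = V at key
  by_cases hV0 : V = 0
  · rw [hV0, zero_mul] at key
    have : J = 0 := le_antisymm key zero_le
    rw [this]; simp
  by_cases hVt : V = ∞
  · rw [hVt]; simp
  rwa [ENNReal.inv_mul_le_iff hV0 hVt]

end final

/-- Embeddings between weighted tent spaces: for 0 < p₀ ≤ p₁ ≤ ∞ and
s ∈ ℝ there is C ≥ 0 such that every F ∈ T^{p₀}_s(S*) vanishing for σ > e satisfies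
‖F‖_{T^{p₁}_{s − n(1/p₀ − 1/p₁)}} ≤ C ‖F‖_{T^{p₀}_s}. -/
theorem tent_space_embedding (n : ℕ) (hn : 2 ≤ n) (p₀ p₁ : ℝ≥0∞) (hp₀ : 0 < p₀)
    (hp : p₀ ≤ p₁) (s : ℝ) :
    ∃ C : ℝ≥0, ∀ F : CoSph n × ℝ → ℂ, Measurable F →
      (∀ q : CoSph n × ℝ, Real.exp 1 < q.2 → F q = 0) →
      tentNorm p₁ (s - (n : ℝ) * (p₀⁻¹.toReal - p₁⁻¹.toReal)) F ≤ C * tentNorm p₀ s F := by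
  suffices h : ∃ C : ℝ≥0∞, C ≠ ∞ ∧ ∀ F : CoSph n × ℝ → ℂ, Measurable F →
      (∀ q : CoSph n × ℝ, Real.exp 1 < q.2 → F q = 0) →
      tentNorm p₁ (s - (n : ℝ) * (p₀⁻¹.toReal - p₁⁻¹.toReal)) F ≤ C * tentNorm p₀ s F by
    obtain ⟨C, hC, h⟩ := h
    refine ⟨C.toNNReal, fun F hF h0 => ?_⟩
    rw [ENNReal.coe_toNNReal hC]
    exact h F hF h0
  by_cases hp1 : p₁ = ∞
  swap
  · exact emb_fin n hn p₀ p₁ hp₀ hp hp1 s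
  subst hp1
  by_cases hp0 : p₀ = ∞
  · subst hp0
    exact ⟨1, by simp, fun F _ _ => by simp⟩
  have hqt : max p₀ 2 ≠ ∞ := by simp [hp0]
  obtain ⟨C1, hC1, h1⟩ := emb_fin n hn p₀ (max p₀ 2) hp₀ (le_max_left _ _) hqt s
  obtain ⟨C2, hC2, h2⟩ := emb_top n hn (max p₀ 2) (le_max_right _ _) hqt
    (s - (n : ℝ) * (p₀⁻¹.toReal - (max p₀ 2)⁻¹.toReal))
  refine ⟨C2 * C1, ENNReal.mul_ne_top hC2 hC1, fun F hF h0 => ?_⟩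
  have a := h2 F hF h0
  rw [show s - (n : ℝ) * (p₀⁻¹.toReal - (max p₀ 2)⁻¹.toReal) - n * (max p₀ 2)⁻¹.toReal =
    s - n * (p₀⁻¹.toReal - (∞ : ℝ≥0∞)⁻¹.toReal) by simp; ring] at a
  calc _ ≤ _ := a
    _ ≤ C2 * (C1 * tentNorm p₀ s F) := by gcongr; exact h1 F hF h0
    _ = _ := by ring
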